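/- arXiv:2507.11880 — 2 statements merged into one kernel-verified Lean document; each statement's English description precedes it below -/
import Mathlib

section
/- Let X_free ⊆ ℝ² and let σ* be a path in X_free from x_s to x_e of finite cost. Then σ* is an optimal homotopic path (i.e., c(σ*) ≤ c(σ′) for every path σ′ in X_free with σ′ ≃_p σ*) if and only if for all t₁ ≤ t₂ in [0,1], the subpath σ*_{[t₁,t₂]} is an optimal homotopic path (i.e., c(σ*_{[t₁,t₂]}) ≤ c(σ′) for every path σ′ in X_free with σ′ ≃_p σ*_{[t₁,t₂]}). -/
noncomputable section

/-- Points of the plane. -/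
abbrev E2 : Type := EuclideanSpace ℝ (Fin 2)

namespace THPP

lemma subIcc_mem (s t₁ t₂ : unitInterval) :
    (1 - s.1) * t₁.1 + s.1 * t₂.1 ∈ Set.Icc (0 : ℝ) 1 := by
  have hs0 : (0:ℝ) ≤ s.1 := s.2.1
  have hs1 : s.1 ≤ 1 := s.2.2
  have ha0 : (0:ℝ) ≤ t₁.1 := t₁.2.1
  have ha1 : t₁.1 ≤ 1 := t₁.2.2
  have hb0 : (0:ℝ) ≤ t₂.1 := t₂.2.1
  have hb1 : t₂.1 ≤ 1 := t₂.2.2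
  constructor
  · have h1 := mul_nonneg (by linarith : (0:ℝ) ≤ 1 - s.1) ha0
    have h2 := mul_nonneg hs0 hb0
    linarith
  · have h1 := mul_nonneg (by linarith : (0:ℝ) ≤ 1 - s.1) (by linarith : (0:ℝ) ≤ 1 - t₁.1)
    have h2 := mul_nonneg hs0 (by linarith : (0:ℝ) ≤ 1 - t₂.1)
    nlinarith

/-- The subpath `σ_{[t₁,t₂]} : s ↦ σ ((1-s)·t₁ + s·t₂)`. -/
def subpath {Y : Type*} [TopologicalSpace Y] {a b : Y} (σ : Path a b) (t₁ t₂ : unitInterval) :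
    Path (σ t₁) (σ t₂) where
  toFun s := σ ⟨(1 - s.1) * t₁.1 + s.1 * t₂.1, subIcc_mem s t₁ t₂⟩
  continuous_toFun := σ.continuous.comp (Continuous.subtype_mk (by fun_prop) _)
  source' := by
    exact congrArg (fun u => σ u) (Subtype.ext (by simp))
  target' := by
    exact congrArg (fun u => σ u) (Subtype.ext (by simp))

/-- The subpath `σ_{[0,t]}`, as a path from the start point of `σ` to `σ t`. -/
def subpath0 {Y : Type*} [TopologicalSpace Y] {a b : Y} (σ : Path a b) (t : unitInterval) :
    Path a (σ t) :=
  (subpath σ 0 t).cast σ.source.symm rfl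

/-- The straight-line path `t ↦ (1-t)·x₀ + t·x₁`, as a path in `X` given that the
segment `[x₀, x₁]` is contained in `X`. -/
def linePath {X : Set E2} {x₀ x₁ : E2} (h₀ : x₀ ∈ X) (h₁ : x₁ ∈ X)
    (hseg : segment ℝ x₀ x₁ ⊆ X) : Path (⟨x₀, h₀⟩ : X) ⟨x₁, h₁⟩ where
  toFun t := ⟨(1 - t.1) • x₀ + t.1 • x₁,
    hseg (by rw [segment_eq_image]; exact ⟨t.1, t.2, rfl⟩)⟩
  continuous_toFun := Continuous.subtype_mk (by fun_prop) _
  source' := Subtype.ext (by simp)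
  target' := Subtype.ext (by simp)

/-- The cost (arc length) of a path in a subset of the plane: the total variation of the
underlying map `[0,1] → ℝ²`. -/
def cost {X : Set E2} {a b : X} (σ : Path a b) : ENNReal :=
  eVariationOn (fun t => (σ t : E2)) Set.univ

/-- A path is an optimal homotopic path if it has minimal cost within its
path-homotopy class (homotopies staying in `X`). -/
def IsOptimal {X : Set E2} {a b : X} (σ : Path a b) : Prop :=
  ∀ σ' : Path a b, σ.Homotopic σ' → cost σ ≤ cost σ'

/-- `m[σ]`: the infimal cost of the path-homotopy class of `σ`. -/
def mCost {X : Set E2} {a b : X} (σ : Path a b) : ENNReal :=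
  ⨅ σ' : {σ' : Path a b // σ.Homotopic σ'}, cost σ'.1

/-- Concatenation `σ₀ * σ₁ * ⋯ * σ_{n-1}` of a chain of paths. -/
def chain {Y : Type*} [TopologicalSpace Y] (x : ℕ → Y)
    (σ : ∀ i : ℕ, Path (x i) (x (i + 1))) : ∀ n : ℕ, Path (x 0) (x n)
  | 0 => Path.refl (x 0)
  | n + 1 => (chain x σ n).trans (σ n)


lemma subpath_eq {Y : Type*} [TopologicalSpace Y] {a b : Y} (σ : Path a b) (t₁ t₂ : unitInterval) :
    subpath σ t₁ t₂ = σ.subpath t₁ t₂ := rfl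

lemma cost_sub {X : Set E2} {a b : X} (σ : Path a b) (t₁ t₂ : unitInterval) (h : t₁ ≤ t₂) :
    cost (σ.subpath t₁ t₂) = eVariationOn (fun t => (σ t : E2)) (Set.Icc t₁ t₂) := by
  have hm : Monotone (Set.Icc.convexComb t₁ t₂) := by
    intro s s' hs
    have h1 : (s : ℝ) ≤ s' := hs
    have h2 : (t₁ : ℝ) ≤ t₂ := h
    change (1 - s.1) * t₁.1 + s.1 * t₂.1 ≤ (1 - s'.1) * t₁.1 + s'.1 * t₂.1
    nlinarith [mul_nonneg (sub_nonneg.2 h1) (sub_nonneg.2 h2)]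
  have := eVariationOn.comp_eq_of_monotoneOn (fun t => (σ t : E2)) (t := Set.univ)
    (Set.Icc.convexComb t₁ t₂) (hm.monotoneOn _)
  rw [Set.image_univ, Path.range_subpathAux, Set.uIcc_of_le h] at this
  exact this

lemma cost_split {X : Set E2} {a b : X} (σ : Path a b) (t : unitInterval) :
    cost σ = cost (σ.subpath 0 t) + cost (σ.subpath t 1) := by
  rw [cost_sub _ _ _ t.2.1, cost_sub _ _ _ t.2.2, cost]
  have := eVariationOn.Icc_add_Icc (fun t => (σ t : E2)) (s := Set.univ)
    (show (0 : unitInterval) ≤ t from t.2.1) (show t ≤ 1 from t.2.2) trivial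
  simp only [Set.univ_inter] at this
  rw [this]
  congr 1
  ext x
  simp only [Set.mem_univ, Set.mem_Icc, true_iff]
  exact ⟨x.2.1, x.2.2⟩

lemma cost_congr {X : Set E2} {a b a' b' : X} (p : Path a b) (q : Path a' b')
    (h : ∀ s, p s = q s) : cost p = cost q := by
  unfold cost
  simp only [h]

lemma cost_trans {X : Set E2} {a b c : X} (p : Path a b) (q : Path b c) :
    cost (p.trans q) = cost p + cost q := by
  rw [cost_split _ ⟨1/2, by norm_num, by norm_num⟩]
  congr 1
  · apply cost_congr
    intro s
    have hs := s.2
    change (p.trans q) ⟨(1 - s.1) * 0 + s.1 * (1/2), _⟩ = _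
    rw [Path.trans_apply, dif_pos (by simp only; linarith [hs.2])]
    congr 1
    ext
    simp only
    ring
  · apply cost_congr
    intro s
    have hs := s.2
    change (p.trans q) ⟨(1 - s.1) * (1/2) + s.1 * 1, _⟩ = _
    rw [Path.trans_apply]
    split_ifs with h
    · simp only at h
      have h0 : s = 0 := by ext; simp only [Set.Icc.coe_zero]; linarith [hs.1]
      subst h0
      simp
    · congr 1
      ext
      simp only
      ring

lemma isOptimal_cast {X : Set E2} {a b a' b' : X} (p : Path a b) (ha : a' = a) (hb : b' = b) :
    IsOptimal (p.cast ha hb) ↔ IsOptimal p := by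
  subst ha hb
  rfl

/-- a path of finite cost is an optimal homotopic path iff every
subpath `σ_{[t₁,t₂]}` (t₁ ≤ t₂) is an optimal homotopic path. -/
theorem optimal_iff_all_subpaths_optimal {X : Set E2} {xs xe : X}
    (σ : Path xs xe) (hfin : cost σ ≠ ⊤) :
    IsOptimal σ ↔
      ∀ t₁ t₂ : unitInterval, t₁ ≤ t₂ → IsOptimal (subpath σ t₁ t₂) := by
  have key : IsOptimal (σ.subpath 0 1) ↔ IsOptimal σ := by
    rw [Path.subpath_zero_one]
    exact isOptimal_cast σ _ _
  have hc : cost (σ.subpath 0 1) = cost σ := by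
    rw [Path.subpath_zero_one]; rfl
  rw [← key]
  refine ⟨fun hopt t₁ t₂ h12 σ' hσ' => ?_, fun h => h 0 1 zero_le_one⟩
  rw [subpath_eq] at *
  have hom : (σ.subpath 0 1).Homotopic
      (((σ.subpath 0 t₁).trans σ').trans (σ.subpath t₂ 1)) := by
    have h1 : ((σ.subpath 0 t₁).trans (σ.subpath t₁ t₂)).Homotopic (σ.subpath 0 t₂) :=
      ⟨Path.Homotopy.subpathTransSubpath σ 0 t₁ t₂⟩
    have h2 : ((σ.subpath 0 t₂).trans (σ.subpath t₂ 1)).Homotopic (σ.subpath 0 1) :=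
      ⟨Path.Homotopy.subpathTransSubpath σ 0 t₂ 1⟩
    refine h2.symm.trans (Path.Homotopic.hcomp ?_ (.refl _))
    exact h1.symm.trans (Path.Homotopic.hcomp (.refl _) hσ')
  have hle := hopt _ hom
  have e1 : cost (σ.subpath 0 t₂) = cost (σ.subpath 0 t₁) + cost (σ.subpath t₁ t₂) := by
    rw [cost_sub _ 0 t₁ t₁.2.1, cost_sub _ 0 t₂ t₂.2.1, cost_sub _ _ _ h12]
    have := eVariationOn.Icc_add_Icc (fun t => (σ t : E2)) (s := Set.univ)
      (show (0 : unitInterval) ≤ t₁ from t₁.2.1) h12 trivial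
    simp only [Set.univ_inter] at this
    exact this.symm
  have e2 := cost_split σ t₂
  rw [cost_trans, cost_trans, hc, e2, e1] at hle
  rw [e2, e1] at hfin
  simp only [ne_eq, ENNReal.add_eq_top, not_or] at hfin
  exact (ENNReal.add_le_add_iff_left hfin.1.1).1 ((ENNReal.add_le_add_iff_right hfin.2).1 hle)

end THPP
end
end

section
/- Let X_free ⊆ ℝ², let σ be a path in X_free ending at x₀ = σ(1), let l be the straight-line path from x₀ to x₁ with segment [x₀,x₁] ⊆ X_free, and define f(t) := m[σ * l_{[0,t]}] for t ∈ [0,1]. Then for all t ∈ [0,1] and all dt with t + dt ∈ [0,1]: f(t) ≤ f(t+dt) + |dt|·‖x₁ − x₀‖ and f(t+dt) ≤ f(t) + |dt|·‖x₁ − x₀‖, where |dt|·‖x₁ − x₀‖ = c(l_{[t,t+dt]}). -/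
noncomputable section

namespace THPP

lemma cost_trans_le {X : Set E2} {a b c : X} (p : Path a b) (q : Path b c) :
    cost (p.trans q) ≤ cost p + cost q := by
  unfold cost
  let h : unitInterval := ⟨1 / 2, by norm_num, by norm_num⟩
  have hu : (Set.univ : Set unitInterval) = Set.Iic h ∪ Set.Ici h := by
    simp
  rw [hu, eVariationOn.union _ isGreatest_Iic isLeast_Ici]
  gcongr
  · let φ : unitInterval → unitInterval := fun t => Set.projIcc 0 1 zero_le_one (2 * t.1)
    have hφ : Monotone φ := fun x y hxy => Set.monotone_projIcc _ (by
      have : x.1 ≤ y.1 := hxy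
      linarith)
    rw [← hu]
    refine le_trans (le_of_eq ?_) (eVariationOn.comp_le_of_monotoneOn
      (fun t => (p t : E2)) φ (hφ.monotoneOn (Set.Iic h)) (Set.mapsTo_univ _ _))
    refine eVariationOn.congr ?_
    intro t ht
    have ht' : t.1 ≤ 1 / 2 := ht
    simp only [Path.trans_apply, Function.comp]
    rw [dif_pos ht']
    congr 2
    exact (Set.projIcc_of_mem zero_le_one _).symm
  · let φ : unitInterval → unitInterval := fun t => Set.projIcc 0 1 zero_le_one (2 * t.1 - 1)
    have hφ : Monotone φ := fun x y hxy => Set.monotone_projIcc _ (by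
      have : x.1 ≤ y.1 := hxy
      linarith)
    rw [← hu]
    refine le_trans (le_of_eq ?_) (eVariationOn.comp_le_of_monotoneOn
      (fun t => (q t : E2)) φ (hφ.monotoneOn (Set.Ici h)) (Set.mapsTo_univ _ _))
    refine eVariationOn.congr ?_
    intro t ht
    have ht' : 1 / 2 ≤ t.1 := ht
    simp only [Path.trans_apply, Function.comp]
    by_cases h2 : t.1 ≤ 1 / 2
    · rw [dif_pos h2]
      have e : t.1 = 1 / 2 := le_antisymm h2 ht'
      have e1 : φ t = 0 := by
        apply Set.projIcc_of_le_left
        rw [e]; norm_num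
      have e2 : (⟨2 * t.1, (unitInterval.mul_pos_mem_iff zero_lt_two).2 ⟨t.2.1, h2⟩⟩ :
          unitInterval) = 1 := by
        apply Subtype.ext
        simp [e]
      rw [e1, e2, Path.source, Path.target]
    · rw [dif_neg h2]
      congr 2
      exact (Set.projIcc_of_mem zero_le_one _).symm

/-- The straight path in the unit interval. -/
def segI (a b : unitInterval) : Path a b where
  toFun s := ⟨(1 - s.1) * a.1 + s.1 * b.1, subIcc_mem s a b⟩
  continuous_toFun := Continuous.subtype_mk (by fun_prop) _
  source' := Subtype.ext (by simp)
  target' := Subtype.ext (by simp)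

lemma subpath_homotopic {Y : Type*} [TopologicalSpace Y] {a b : Y} (l : Path a b)
    (s t : unitInterval) :
    ((subpath0 l s).trans (subpath l s t)).Homotopic (subpath0 l t) := by
  haveI : ContractibleSpace unitInterval :=
    (convex_Icc (0:ℝ) 1).contractibleSpace ⟨0, by simp⟩
  have h : (((segI 0 s).trans (segI s t)).map l.continuous).Homotopic
      ((segI 0 t).map l.continuous) :=
    (SimplyConnectedSpace.paths_homotopic _ _).map ⟨l, l.continuous⟩
  rw [Path.map_trans] at h
  have key : ((subpath l 0 s).trans (subpath l s t)).Homotopic (subpath l 0 t) := h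
  have h2 := key.pathCast l.source.symm rfl
  exact h2

lemma mCost_step {X : Set E2} {xa a b : X} (σ : Path xa a) (l : Path a b)
    (s t : unitInterval) :
    mCost (σ.trans (subpath0 l t)) ≤
      mCost (σ.trans (subpath0 l s)) + cost (subpath l s t) := by
  unfold mCost
  rw [ENNReal.iInf_add]
  refine le_iInf ?_
  rintro ⟨τ, hτ⟩
  refine iInf_le_of_le ⟨τ.trans (subpath l s t), ?_⟩ (cost_trans_le _ _)
  have h1 : (σ.trans (subpath0 l t)).Homotopic
      (σ.trans ((subpath0 l s).trans (subpath l s t))) :=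
    (Path.Homotopic.refl σ).hcomp (subpath_homotopic l s t).symm
  have h2 : ((σ.trans (subpath0 l s)).trans (subpath l s t)).Homotopic
      (σ.trans ((subpath0 l s).trans (subpath l s t))) :=
    ⟨Path.Homotopy.transAssoc _ _ _⟩
  exact (h1.trans h2.symm).trans (hτ.hcomp (Path.Homotopic.refl _))

lemma cost_line {X : Set E2} {x₀ x₁ : E2}
    (h₀ : x₀ ∈ X) (h₁ : x₁ ∈ X) (hseg : segment ℝ x₀ x₁ ⊆ X) (s t : unitInterval) :
    cost (subpath (linePath h₀ h₁ hseg) s t) =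
      ENNReal.ofReal (|t.1 - s.1| * ‖x₁ - x₀‖) := by
  let F : ℝ → E2 := fun u => (1 - ((1 - u) * s.1 + u * t.1)) • x₀ + ((1 - u) * s.1 + u * t.1) • x₁
  have hF : ∀ u v : ℝ, dist (F u) (F v) = (|t.1 - s.1| * ‖x₁ - x₀‖) * dist u v := by
    intro u v
    have : F u - F v = ((t.1 - s.1) * (u - v)) • (x₁ - x₀) := by
      simp only [F]
      module
    rw [dist_eq_norm, this, norm_smul, norm_mul, Real.dist_eq, Real.norm_eq_abs, Real.norm_eq_abs]
    ring
  have hcost : cost (subpath (linePath h₀ h₁ hseg) s t) =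
      eVariationOn (F ∘ (Subtype.val : unitInterval → ℝ)) Set.univ := rfl
  have hnn : 0 ≤ |t.1 - s.1| * ‖x₁ - x₀‖ := by positivity
  rw [hcost]
  apply le_antisymm
  · have hL : LipschitzWith (Real.toNNReal (|t.1 - s.1| * ‖x₁ - x₀‖)) F := by
      refine LipschitzWith.of_dist_le_mul fun u v => ?_
      rw [hF, Real.coe_toNNReal _ hnn]
    refine (hL.lipschitzOnWith (s := Set.univ)).comp_eVariationOn_le
      (Set.mapsTo_univ _ _) |>.trans ?_
    have hv : eVariationOn (Subtype.val : unitInterval → ℝ) Set.univ ≤ 1 := by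
      have h1 := eVariationOn.comp_le_of_monotoneOn (fun x : ℝ => x) (s := Set.Icc (0:ℝ) 1)
        (t := Set.univ) (Subtype.val : unitInterval → ℝ)
        (fun x _ y _ hxy => hxy) (fun x _ => x.2)
      have h2 := (monotone_id (α := ℝ)).monotoneOn (Set.Icc (0:ℝ) 1) |>.eVariationOn_eq
        (a := 0) (b := 1) (by simp) (by simp)
      rw [Set.inter_self] at h2
      refine h1.trans (h2.le.trans ?_)
      simp
    calc _ ≤ ENNReal.ofReal (|t.1 - s.1| * ‖x₁ - x₀‖) * 1 := by
          gcongr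
          exact le_rfl
      _ = _ := mul_one _
  · have := eVariationOn.edist_le (F ∘ (Subtype.val : unitInterval → ℝ))
      (Set.mem_univ (1 : unitInterval)) (Set.mem_univ (0 : unitInterval))
    refine le_trans (le_of_eq ?_) this
    rw [edist_dist]
    simp only [Function.comp]
    rw [hF]
    simp


/-- the function `f(t) = m[σ * l_{[0,t]}]` satisfies the Lipschitz-type
inequalities `f(t) ≤ f(t+dt) + |dt|·‖x₁ - x₀‖` and `f(t+dt) ≤ f(t) + |dt|·‖x₁ - x₀‖`,
where `|dt|·‖x₁ - x₀‖ = c(l_{[t,t+dt]})`. -/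
theorem mcost_line_lipschitz {X : Set E2} {xa : X} {x₀ x₁ : E2}
    (h₀ : x₀ ∈ X) (h₁ : x₁ ∈ X) (hseg : segment ℝ x₀ x₁ ⊆ X)
    (σ : Path xa (⟨x₀, h₀⟩ : X))
    (f : unitInterval → ENNReal)
    (hf : ∀ t, f t = mCost (σ.trans (subpath0 (linePath h₀ h₁ hseg) t)))
    (t : unitInterval) (dt : ℝ) (ht : t.1 + dt ∈ Set.Icc (0:ℝ) 1) :
    f t ≤ f ⟨t.1 + dt, ht⟩ + ENNReal.ofReal (|dt| * ‖x₁ - x₀‖) ∧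
    f ⟨t.1 + dt, ht⟩ ≤ f t + ENNReal.ofReal (|dt| * ‖x₁ - x₀‖) ∧
    ENNReal.ofReal (|dt| * ‖x₁ - x₀‖) =
      cost (subpath (linePath h₀ h₁ hseg) t ⟨t.1 + dt, ht⟩) := by
  have e1 := cost_line h₀ h₁ hseg t ⟨t.1 + dt, ht⟩
  have e2 := cost_line h₀ h₁ hseg ⟨t.1 + dt, ht⟩ t
  have r1 : t.1 + dt - t.1 = dt := by ring
  have r2 : t.1 - (t.1 + dt) = -dt := by ring
  simp only [r1] at e1
  simp only [r2, abs_neg] at e2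
  refine ⟨?_, ?_, e1.symm⟩
  · rw [hf, hf, ← e2]
    exact mCost_step _ _ _ _
  · rw [hf, hf, ← e1]
    exact mCost_step _ _ _ _

end THPP
end
end
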